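/- For V and W finite-dimensional vector spaces with endomorphisms f, g, the characteristic-type polynomial det(Id − u · f ⊗ g) equals Σ_{j=0}^{dim V · dim W} (−u)^j Σ_{|λ|=j} tr ρ_{λ'}(g) · tr ρ_λ(f), where the inner sum runs over partitions λ of j fitting in a (dim V) × (dim W) box. -/

import Mathlib

open Matrix Polynomial

noncomputable section

/-- Complete homogeneous symmetric function `h_m` in `N` variables. -/
def hSym {R : Type*} [CommRing R] (N m : ℕ) (x : Fin N → R) : R :=
  ∑ s : Sym (Fin N) m, (s.1.map x).prod

def hSymZ {R : Type*} [CommRing R] (N : ℕ) (x : Fin N → R) (d : ℤ) : R :=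
  if 0 ≤ d then hSym N d.toNat x else 0

/-- Schur polynomial, via the Jacobi–Trudi formula, of a partition given as its
list of parts in decreasing order.  `schurFn N l x` is the trace of the Schur
functor `S_l` applied to an endomorphism with eigenvalues `x`. -/
def schurFn {R : Type*} [CommRing R] (N : ℕ) (l : List ℕ) (x : Fin N → R) : R :=
  Matrix.det (Matrix.of fun i j : Fin l.length =>
    hSymZ N x ((l.get i : ℤ) + (j : ℤ) - (i : ℤ)))

/-- Conjugate partition of a partition given as a list of parts. -/
def conjList (l : List ℕ) : List ℕ :=
  (List.range (l.foldr max 0)).map fun i => (l.filter (fun a => i < a)).length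

/-- The parts of a partition, as a decreasingly sorted list. -/
def partsList {j : ℕ} (μ : Nat.Partition j) : List ℕ :=
  (μ.parts.sort (· ≤ ·)).reverse

lemma charpolyRev_eq_prod {n : ℕ} {R : Type*} [CommRing R] [IsDomain R]
    {F : Matrix (Fin n) (Fin n) R} {a : Fin n → R}
    (h : F.charpoly = ∏ i, (X - C (a i))) :
    F.charpolyRev = ∏ i, (1 - C (a i) * X) := by
  rw [← Matrix.reverse_charpoly, h]
  have : ∀ s : Finset (Fin n),
      (∏ i ∈ s, (X - C (a i))).reverse = ∏ i ∈ s, (1 - C (a i) * X) := by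
    intro s
    induction s using Finset.induction_on with
    | empty => simpa using reverse_C (1 : R)
    | insert i s hi ih =>
      rw [Finset.prod_insert hi, Finset.prod_insert hi, reverse_mul_of_domain, ih, sub_eq_add_neg,
        ← C_neg, reverse_add_C]
      congr 1
      simp [reverse, sub_eq_add_neg, reflect_one_X]
  exact this _

lemma det_one_sub_smul_eq_prod {n : ℕ} {R : Type*} [CommRing R] [IsDomain R]
    {F : Matrix (Fin n) (Fin n) R} {a : Fin n → R}
    (h : F.charpoly = ∏ i, (X - C (a i))) (c : R) :
    (1 - c • F).det = ∏ i, (1 - a i * c) := by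
  have := congrArg (evalRingHom c) (charpolyRev_eq_prod h)
  rw [charpolyRev, RingHom.map_det, map_prod] at this
  simp only [map_sub, map_one, map_mul, coe_evalRingHom, eval_C, eval_X] at this
  rw [← this]
  congr 1
  ext i j
  simp
  exact mul_comm _ _

lemma det_one_sub_smul_kronecker_eq_prod {n m : ℕ} {R : Type*} [CommRing R] [IsDomain R]
    {F : Matrix (Fin n) (Fin n) R} {G : Matrix (Fin m) (Fin m) R}
    {a : Fin n → R} {b : Fin m → R}
    (hF : F.charpoly = ∏ i, (X - C (a i))) (hG : G.charpoly = ∏ i, (X - C (b i))) (u : R) :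
    (1 - u • Matrix.kroneckerMap (· * ·) F G).det = ∏ i, ∏ j, (1 - a i * (u * b j)) := by
  let f : R[X] →+* Matrix (Fin m) (Fin m) R := (aeval (u • G)).toRingHom
  have key := Matrix.det_det (1 - (X : R[X]) • F.map C) f
  have h1 : (1 - (X : R[X]) • F.map C).det = ∏ i, (1 - C (a i) * X) := charpolyRev_eq_prod hF
  have h2 : (((1 - (X : R[X]) • F.map C).map f).comp _ _ _ _ R) =
      1 - u • Matrix.kroneckerMap (· * ·) F G := by
    ext ⟨i, k⟩ ⟨j, l⟩
    by_cases hij : i = j <;> by_cases hkl : k = l <;>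
      simp [f, hij, hkl, Matrix.comp_apply, Algebra.algebraMap_eq_smul_one]
  let g : R[X] →* R := Matrix.detMonoidHom.comp f.toMonoidHom
  have hg : ∀ p, g p = (f p).det := fun _ => rfl
  rw [← h2, ← key, h1, ← hg, map_prod]
  refine Finset.prod_congr rfl fun i _ => ?_
  have : f (1 - C (a i) * X) = 1 - (a i * u) • G := by
    simp [f, Algebra.algebraMap_eq_smul_one, smul_smul, mul_comm u]
  rw [hg, this, det_one_sub_smul_eq_prod hG]
  exact Finset.prod_congr rfl fun j _ => by ring

lemma powerSeries_mk_hSym_eq_prod {R : Type*} [CommRing R] (N : ℕ) (x : Fin N → R) :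
    PowerSeries.mk (fun d => hSym N d x) = ∏ i, PowerSeries.mk (fun d => x i ^ d) := by
  ext d
  rw [PowerSeries.coeff_prod, PowerSeries.coeff_mk, hSym]
  simp only [PowerSeries.coeff_mk]
  refine Finset.sum_bij' (fun s _ => Multiset.toFinsupp s.1)
    (fun f hf => ⟨Finsupp.toMultiset f, ?_⟩) ?_ ?_ ?_ ?_ ?_
  · rw [Finset.mem_finsuppAntidiag] at hf
    rw [Finsupp.card_toMultiset, ← hf.1, Finsupp.sum_fintype _ _ (fun _ => rfl)]
    rfl
  · intro s _
    rw [Finset.mem_finsuppAntidiag]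
    refine ⟨?_, Finset.subset_univ _⟩
    exact (Multiset.sum_count_eq_card fun a _ => Finset.mem_univ a).trans s.2
  · intros
    exact Finset.mem_univ _
  · intro s _
    ext
    simp
  · simp
  · intro s _
    simp only [Finset.prod_multiset_map_count, Multiset.toFinsupp_apply]
    refine Finset.prod_subset (Finset.subset_univ _) fun i _ hi => ?_
    rw [Multiset.count_eq_zero_of_notMem (by simpa using hi), pow_zero]

lemma mk_pow_mul_one_sub {R : Type*} [CommRing R] (a : R) :
    PowerSeries.mk (fun d => a ^ d) * (1 - PowerSeries.C a * PowerSeries.X) = 1 := by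
  ext d
  rw [mul_sub, mul_one, ← mul_assoc, map_sub, mul_comm _ (PowerSeries.C a)]
  cases d with
  | zero => simp
  | succ d => simp [PowerSeries.coeff_succ_mul_X, pow_succ', PowerSeries.coeff_one]

lemma hSymZ_zero {R : Type*} [CommRing R] (N : ℕ) (x : Fin N → R) : hSymZ N x 0 = 1 := by
  have := congrArg (PowerSeries.coeff 0) (powerSeries_mk_hSym_eq_prod N x)
  simpa [hSymZ, map_prod] using this

lemma hSymZ_of_neg {R : Type*} [CommRing R] (N : ℕ) (x : Fin N → R) {d : ℤ} (hd : d < 0) :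
    hSymZ N x d = 0 := by
  rw [hSymZ, if_neg (by omega)]

/-- Each power `x i ^ c` is a combination of `h_c, …, h_{c-n+1}` with coefficients independent
of `c`. -/
lemma exists_pow_eq_sum_mul_hSymZ {R : Type*} [CommRing R] {n : ℕ} (x : Fin n → R) :
    ∃ A : Matrix (Fin n) (Fin n) R, ∀ (i : Fin n) (c : ℕ),
      x i ^ c = ∑ k, A i k * hSymZ n x ((c : ℤ) - (k : ℤ)) := by
  let p (i : Fin n) : R[X] := ∏ l ∈ Finset.univ.erase i, (1 - C (x l) * X)
  have hdeg (i : Fin n) (k : ℕ) (hk : n ≤ k) : (p i).coeff k = 0 := by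
    apply coeff_eq_zero_of_natDegree_lt
    refine lt_of_le_of_lt (natDegree_prod_le _ _) ?_
    refine lt_of_le_of_lt (Finset.sum_le_card_nsmul _ _ 1 fun l _ => ?_) ?_
    · refine (natDegree_sub_le _ _).trans ?_
      simpa using (natDegree_C_mul_le (x l) X).trans natDegree_X_le
    · have := i.pos
      simp
      omega
  have hp (i : Fin n) : PowerSeries.mk (fun d => x i ^ d) =
      (p i : PowerSeries R) * PowerSeries.mk (fun d => hSym n d x) := by
    rw [powerSeries_mk_hSym_eq_prod, ← Finset.mul_prod_erase _ _ (Finset.mem_univ i), mul_left_comm]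
    have h : (p i : PowerSeries R) =
        ∏ l ∈ Finset.univ.erase i, (1 - PowerSeries.C (x l) * PowerSeries.X) := by
      rw [← coeToPowerSeries.ringHom_apply, map_prod]
      simp
    rw [h, ← Finset.prod_mul_distrib, Finset.prod_eq_one, mul_one]
    intro l _
    rw [mul_comm, mk_pow_mul_one_sub]
  refine ⟨Matrix.of fun i k => (p i).coeff k, fun i c => ?_⟩
  have h := congrArg (PowerSeries.coeff c) (hp i)
  rw [PowerSeries.coeff_mk, PowerSeries.coeff_mul, Finset.Nat.sum_antidiagonal_eq_sum_range_succ_mk]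
    at h
  simp only [PowerSeries.coeff_mk, Polynomial.coeff_coe] at h
  rw [h]
  simp only [Matrix.of_apply]
  rw [Fin.sum_univ_eq_sum_range (fun k => (p i).coeff k * hSymZ n x ((c : ℤ) - (k : ℤ))) n]
  trans ∑ k ∈ Finset.range (c + 1), (p i).coeff k * hSymZ n x ((c : ℤ) - (k : ℤ))
  · refine Finset.sum_congr rfl fun k hk => ?_
    have := Finset.mem_range.1 hk
    rw [hSymZ, if_pos (by omega)]
    congr 2
    omega
  trans ∑ k ∈ Finset.range (c + 1 + n), (p i).coeff k * hSymZ n x ((c : ℤ) - (k : ℤ))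
  · refine Finset.sum_subset (Finset.range_subset_range.2 (by omega)) fun k _ hk => ?_
    rw [hSymZ_of_neg _ _ (by simp at hk; omega), mul_zero]
  · refine (Finset.sum_subset (Finset.range_subset_range.2 (by omega)) fun k _ hk => ?_).symm
    rw [hdeg i k (by simpa using hk), zero_mul]

/-- The `k × k` Jacobi–Trudi determinant of a sequence. -/
def jacobiTrudi {R : Type*} [CommRing R] (N : ℕ) (x : Fin N → R) (k : ℕ) (l : ℕ → ℕ) : R :=
  Matrix.det (Matrix.of fun i j : Fin k => hSymZ N x ((l i : ℤ) + (j : ℤ) - (i : ℤ)))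

lemma jacobiTrudi_succ {R : Type*} [CommRing R] {N : ℕ} (x : Fin N → R) {k : ℕ} {l : ℕ → ℕ}
    (hl : l k = 0) : jacobiTrudi N x (k + 1) l = jacobiTrudi N x k l := by
  rw [jacobiTrudi, Matrix.det_succ_row _ (Fin.last k), Fin.sum_univ_castSucc, Finset.sum_eq_zero,
    zero_add]
  · simp [hl, hSymZ_zero, jacobiTrudi, ← two_mul]
    rfl
  · intro i _
    rw [Matrix.of_apply, hSymZ_of_neg, mul_zero, zero_mul]
    simp [hl]

lemma jacobiTrudi_eq_of_le {R : Type*} [CommRing R] {N : ℕ} (x : Fin N → R) {k k' : ℕ} {l : ℕ → ℕ}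
    (hk : k ≤ k') (hl : ∀ i, k ≤ i → l i = 0) : jacobiTrudi N x k' l = jacobiTrudi N x k l := by
  induction k', hk using Nat.le_induction with
  | base => rfl
  | succ k' hk ih => rw [jacobiTrudi_succ x (hl k' hk), ih]

lemma schurFn_eq_jacobiTrudi {R : Type*} [CommRing R] {N : ℕ} (x : Fin N → R) {l : List ℕ} {k : ℕ}
    (hk : l.length ≤ k) : schurFn N l x = jacobiTrudi N x k (fun i => l.getD i 0) := by
  rw [jacobiTrudi_eq_of_le x hk (fun i hi => List.getD_eq_default _ _ hi)]
  simp [schurFn, jacobiTrudi]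

/-- Jacobi's bialternant formula. -/
lemma det_pow_eq_mul_jacobiTrudi {R : Type*} [CommRing R] {n : ℕ} (x : Fin n → R) (l : ℕ → ℕ) :
    (Matrix.of fun i j : Fin n => x i ^ (l j + (j.rev : ℕ))).det =
      (Matrix.of fun i j : Fin n => x i ^ (j.rev : ℕ)).det * jacobiTrudi n x n l := by
  obtain ⟨A, hA⟩ := exists_pow_eq_sum_mul_hSymZ x
  have key (l : ℕ → ℕ) : (Matrix.of fun i j : Fin n => x i ^ (l j + (j.rev : ℕ))) =
      (A.submatrix id Fin.revPerm) * (Matrix.of fun i j : Fin n =>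
        hSymZ n x ((l i : ℤ) + (j : ℤ) - (i : ℤ)))ᵀ := by
    ext i j
    rw [Matrix.of_apply, hA, Matrix.mul_apply, ← Equiv.sum_comp Fin.revPerm]
    refine Finset.sum_congr rfl fun k _ => ?_
    simp only [Matrix.submatrix_apply, Matrix.transpose_apply, Matrix.of_apply, id,
      Fin.revPerm_apply]
    congr 2
    simp only [Fin.val_rev]
    omega
  have key0 := congrArg Matrix.det (key fun _ => 0)
  rw [Matrix.det_mul, Matrix.det_transpose] at key0
  have h1 : jacobiTrudi n x n (fun _ => 0) = 1 := by
    rw [jacobiTrudi_eq_of_le x (Nat.zero_le n) (fun _ _ => rfl)]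
    simp [jacobiTrudi]
  rw [jacobiTrudi] at h1
  rw [h1, mul_one] at key0
  simp only [zero_add] at key0
  rw [key l, Matrix.det_mul, Matrix.det_transpose, key0, jacobiTrudi]

lemma hSymZ_smul {R : Type*} [CommRing R] {N : ℕ} (u : R) (x : Fin N → R) (d : ℤ) :
    hSymZ N (fun i => u * x i) d = u ^ d.toNat * hSymZ N x d := by
  unfold hSymZ
  split_ifs
  · simp [hSym, Multiset.prod_map_mul, Finset.mul_sum]
  · simp

lemma jacobiTrudi_smul {R : Type*} [CommRing R] {N : ℕ} (u : R) (x : Fin N → R) (k : ℕ)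
    (l : ℕ → ℕ) : jacobiTrudi N (fun i => u * x i) k l =
      u ^ (∑ i : Fin k, l i) * jacobiTrudi N x k l := by
  simp only [jacobiTrudi, Matrix.det_apply, Finset.mul_sum, Matrix.of_apply, hSymZ_smul]
  refine Finset.sum_congr rfl fun σ _ => ?_
  rw [mul_smul_comm, Finset.prod_mul_distrib, Finset.prod_pow_eq_pow_sum]
  congr 1
  by_cases h : ∀ i : Fin k, (0 : ℤ) ≤ (l (σ i) : ℤ) + (i : ℤ) - (σ i : ℤ)
  · congr 2
    zify
    have h' : ∀ i : Fin k, (((l (σ i) : ℤ) + (i : ℤ) - (σ i : ℤ)).toNat : ℤ) =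
      (l (σ i) : ℤ) + (i : ℤ) - (σ i : ℤ) := fun i => Int.toNat_of_nonneg (h i)
    simp only [h', Finset.sum_sub_distrib, Finset.sum_add_distrib]
    rw [Equiv.sum_comp σ (fun i => (l i : ℤ)), Equiv.sum_comp σ (fun i => ((i : ℕ) : ℤ))]
    ring
  · push Not at h
    obtain ⟨i, hi⟩ := h
    rw [Finset.prod_eq_zero (Finset.mem_univ i) (hSymZ_of_neg N x hi), mul_zero, mul_zero]

lemma prod_prod_Ioi_add {M : Type*} [CommMonoid M] {n m : ℕ} (f : Fin (n + m) → Fin (n + m) → M) :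
    ∏ i, ∏ j ∈ Finset.Ioi i, f i j =
      (∏ i, ∏ j ∈ Finset.Ioi i, f (Fin.castAdd m i) (Fin.castAdd m j)) *
      (∏ i, ∏ j, f (Fin.castAdd m i) (Fin.natAdd n j)) *
      ∏ i, ∏ j ∈ Finset.Ioi i, f (Fin.natAdd n i) (Fin.natAdd n j) := by
  have h {k : ℕ} (i : Fin k) (g : Fin k → M) :
      ∏ j ∈ Finset.Ioi i, g j = ∏ j, if i < j then g j else 1 := by
    rw [← Finset.prod_filter]
    congr 1
    ext
    simp
  have h1 (i : Fin m) (j : Fin n) : ¬ Fin.natAdd n i < Fin.castAdd m j := by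
    simp [Fin.lt_def]
    omega
  have h2 (i : Fin n) (j : Fin m) : Fin.castAdd m i < Fin.natAdd n j := by
    simp [Fin.lt_def]
    omega
  have h3 (i j : Fin n) : Fin.castAdd m i < Fin.castAdd m j ↔ i < j := Iff.rfl
  simp only [h, Fin.prod_univ_add, h1, h2, h3, if_true, if_false, Finset.prod_const_one, mul_one,
    Finset.prod_mul_distrib, Fin.natAdd_lt_natAdd_iff, mul_assoc]

lemma card_filter_lt_fin {k : ℕ} (a : Fin k) : (Finset.univ.filter fun b => b < a).card = a := by
  rw [← Fin.card_Iio]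
  congr 1
  ext
  simp

/-- The subsets of `Fin (n + m)` of cardinality `n`. -/
abbrev FinsetOfCard (n m : ℕ) := {S : Finset (Fin (n + m)) // S.card = n}

namespace FinsetOfCard

variable {n m : ℕ} (S : FinsetOfCard n m)

lemma card_compl : (S.1ᶜ).card = m := by
  rw [Finset.card_compl, S.2, Fintype.card_fin, Nat.add_sub_cancel_left]

/-- Increasing enumeration of `S`. -/
def inEmb : Fin n ↪o Fin (n + m) := S.1.orderEmbOfFin S.2

/-- Increasing enumeration of the complement of `S`. -/
def outEmb : Fin m ↪o Fin (n + m) := S.1ᶜ.orderEmbOfFin S.card_compl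

/-- The permutation listing first `S`, then its complement, each in increasing order, after
permuting the two blocks. -/
def shufflePerm (p : Equiv.Perm (Fin n) × Equiv.Perm (Fin m)) : Equiv.Perm (Fin (n + m)) :=
  finSumFinEquiv.symm.trans
    ((Equiv.Perm.sumCongr p.1 p.2).trans (finSumEquivOfFinset S.2 S.card_compl))

@[simp] lemma shufflePerm_castAdd (p) (i : Fin n) :
    S.shufflePerm p (Fin.castAdd m i) = S.inEmb (p.1 i) := by
  simp [shufflePerm, inEmb]

@[simp] lemma shufflePerm_natAdd (p) (i : Fin m) :
    S.shufflePerm p (Fin.natAdd n i) = S.outEmb (p.2 i) := by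
  simp [shufflePerm, outEmb]

lemma range_inEmb : Set.range S.inEmb = S.1 := Finset.range_orderEmbOfFin _ _

lemma inEmb_ne_outEmb (i : Fin n) (j : Fin m) : S.inEmb i ≠ S.outEmb j := by
  intro h
  have h1 := S.1.orderEmbOfFin_mem S.2 i
  have h2 := S.1ᶜ.orderEmbOfFin_mem S.card_compl j
  rw [Finset.mem_compl] at h2
  exact h2 (h ▸ h1)

lemma sign_shufflePerm (p) :
    (S.shufflePerm p).sign = (S.shufflePerm 1).sign * (p.1.sign * p.2.sign) := by
  have : S.shufflePerm p =
      S.shufflePerm 1 * finSumFinEquiv.permCongr (Equiv.Perm.sumCongr p.1 p.2) := by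
    ext i
    simp [shufflePerm, Equiv.permCongr_apply]
  rw [this, map_mul, Equiv.Perm.sign_permCongr, Equiv.Perm.sign_sumCongr]

lemma eq_of_inEmb_eq {S T : FinsetOfCard n m} (h : ∀ i, ∃ j, S.inEmb i = T.inEmb j) : S = T := by
  apply Subtype.ext
  refine Finset.eq_of_subset_of_card_le ?_ (by rw [S.2, T.2])
  intro a ha
  rw [← Finset.mem_coe, ← range_inEmb] at ha ⊢
  obtain ⟨i, rfl⟩ := ha
  obtain ⟨j, hj⟩ := h i
  exact ⟨j, hj.symm⟩

lemma shufflePerm_bijective : Function.Bijective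
    (fun q : FinsetOfCard n m × (Equiv.Perm (Fin n) × Equiv.Perm (Fin m)) =>
      q.1.shufflePerm q.2) := by
  rw [Fintype.bijective_iff_injective_and_card]
  constructor
  · rintro ⟨S, p⟩ ⟨T, q⟩ h
    simp only at h
    have hST : S = T := eq_of_inEmb_eq fun i => ⟨q.1 (p.1.symm i), by
      simpa using DFunLike.congr_fun h (Fin.castAdd m (p.1.symm i))⟩
    subst hST
    refine Prod.ext rfl (Prod.ext (Equiv.ext fun i => ?_) (Equiv.ext fun i => ?_))
    · simpa using DFunLike.congr_fun h (Fin.castAdd m i)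
    · simpa using DFunLike.congr_fun h (Fin.natAdd n i)
  · simp only [Fintype.card_prod, Fintype.card_finset_len, Fintype.card_perm, Fintype.card_fin]
    rw [← mul_assoc, Nat.choose_symm_add, Nat.add_choose_mul_factorial_mul_factorial]

/-- The Laplace expansion of a determinant along its first `n` rows. -/
lemma det_eq_sum_shufflePerm {R : Type*} [CommRing R]
    (Z : Matrix (Fin (n + m)) (Fin (n + m)) R) :
    Z.det = ∑ S : FinsetOfCard n m, ((S.shufflePerm 1).sign : ℤ) *
      ((Z.submatrix (Fin.castAdd m) S.inEmb).det * (Z.submatrix (Fin.natAdd n) S.outEmb).det) := by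
  rw [← Matrix.det_transpose, Matrix.det_apply', ← shufflePerm_bijective.sum_comp,
    Fintype.sum_prod_type]
  refine Finset.sum_congr rfl fun S _ => ?_
  rw [← Matrix.det_transpose (Z.submatrix (Fin.castAdd m) S.inEmb),
    ← Matrix.det_transpose (Z.submatrix (Fin.natAdd n) S.outEmb), Matrix.det_apply',
    Matrix.det_apply', Finset.sum_mul_sum, Fintype.sum_prod_type, Finset.mul_sum]
  refine Finset.sum_congr rfl fun α _ => ?_
  rw [Finset.mul_sum]
  refine Finset.sum_congr rfl fun β _ => ?_
  rw [sign_shufflePerm, Fin.prod_univ_add]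
  simp only [Matrix.transpose_apply, Matrix.submatrix_apply, shufflePerm_castAdd,
    shufflePerm_natAdd]
  push_cast
  ring

/-- The number of elements of the complement of `S` below the `i`-th element of `S`: the parts, in
increasing order, of the partition attached to `S`. -/
def part (i : Fin n) : ℕ := (Finset.univ.filter fun j => S.outEmb j < S.inEmb i).card

lemma card_filter_inEmb_add_outEmb (a : Fin (n + m)) :
    (Finset.univ.filter fun i => S.inEmb i < a).card +
      (Finset.univ.filter fun j => S.outEmb j < a).card = a := by
  have h := Fintype.card_congr ((S.shufflePerm 1).subtypeEquiv
    (p := fun b => S.shufflePerm 1 b < a) (q := fun b => b < a) fun _ => Iff.rfl)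
  rw [Fintype.card_subtype, Fintype.card_subtype, Finset.card_filter, Fin.sum_univ_add] at h
  simp only [shufflePerm_castAdd, shufflePerm_natAdd, ← Finset.card_filter, Prod.fst_one,
    Prod.snd_one, Equiv.Perm.one_apply] at h
  rw [h, card_filter_lt_fin]

lemma inEmb_eq (i : Fin n) : (S.inEmb i : ℕ) = i + S.part i := by
  rw [← S.card_filter_inEmb_add_outEmb]
  simp [part, card_filter_lt_fin]

lemma outEmb_eq (j : Fin m) :
    (S.outEmb j : ℕ) = (Finset.univ.filter fun i => S.inEmb i < S.outEmb j).card + j := by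
  rw [← S.card_filter_inEmb_add_outEmb]
  simp [card_filter_lt_fin]

lemma part_mono : Monotone S.part := fun _ _ h =>
  Finset.card_le_card <| Finset.monotone_filter_right _ fun _ _ hk =>
    hk.trans_le (S.inEmb.monotone h)

lemma part_le (i : Fin n) : S.part i ≤ m := (Finset.card_filter_le _ _).trans (by simp)

lemma lt_part_iff (i : Fin n) (j : Fin m) : (j : ℕ) < S.part i ↔ S.outEmb j < S.inEmb i := by
  constructor
  · intro h
    by_contra! hj
    have : S.part i ≤ (Finset.Iio j).card := Finset.card_le_card fun k hk => by
      rw [Finset.mem_filter] at hk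
      simpa using hk.2.trans_le hj
    rw [Fin.card_Iio] at this
    omega
  · intro h
    have : (Finset.Iic j).card ≤ S.part i := Finset.card_le_card fun k hk => by
      rw [Finset.mem_Iic] at hk
      simpa using (S.outEmb.monotone hk).trans_lt h
    rw [Fin.card_Iic] at this
    omega

/-- The parts of the partition attached to `S`, in decreasing order, padded with zeros. -/
def parts (k : ℕ) : ℕ := if h : k < n then S.part (Fin.rev ⟨k, h⟩) else 0

/-- The parts of the conjugate of the partition attached to `S`. -/
def conjParts (k : ℕ) : ℕ := (Finset.univ.filter fun i => k < S.part i).card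

lemma inEmb_rev (i : Fin n) : (S.inEmb i.rev : ℕ) = S.parts i + i.rev := by
  rw [inEmb_eq, parts, dif_pos i.2, add_comm]

lemma rev_outEmb (j : Fin m) : ((S.outEmb j).rev : ℕ) = S.conjParts j + j.rev := by
  have h1 := S.outEmb_eq j
  have h2 : (Finset.univ.filter fun i => S.inEmb i < S.outEmb j).card + S.conjParts j = n := by
    rw [conjParts]
    simp only [lt_part_iff]
    have : (Finset.univ.filter fun i => S.outEmb j < S.inEmb i) =
        Finset.univ.filter fun i => ¬ S.inEmb i < S.outEmb j := by
      ext i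
      simp [le_iff_lt_or_eq, (S.inEmb_ne_outEmb i j).symm]
    rw [this, Finset.card_filter_add_card_filter_not, Finset.card_univ, Fintype.card_fin]
  rw [Fin.val_rev, Fin.val_rev]
  omega

lemma sum_conjParts : ∑ j : Fin m, S.conjParts j = ∑ i, S.part i := by
  simp only [conjParts, lt_part_iff]
  simp only [part, Finset.card_filter]
  rw [Finset.sum_comm]

lemma sign_shufflePerm_one : ((S.shufflePerm 1).sign : ℤ) = (-1) ^ ∑ i, S.part i := by
  rw [Equiv.Perm.sign_eq_prod_prod_Ioi, prod_prod_Ioi_add]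
  simp only [shufflePerm_castAdd, shufflePerm_natAdd, Prod.fst_one, Prod.snd_one,
    Equiv.Perm.one_apply, OrderEmbedding.lt_iff_lt]
  rw [Finset.prod_eq_one, Finset.prod_eq_one (s := Finset.univ) (f := fun i : Fin m => _), one_mul,
    mul_one, ← Finset.prod_pow_eq_pow_sum]
  · push_cast
    refine Finset.prod_congr rfl fun i _ => ?_
    rw [part, ← Finset.prod_const, Finset.prod_filter]
    refine Finset.prod_congr rfl fun j _ => ?_
    rcases lt_or_gt_of_ne (S.inEmb_ne_outEmb i j) with h | h <;> simp [h, h.not_gt]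
  · exact fun i _ => Finset.prod_eq_one fun j hj => if_pos (Finset.mem_Ioi.1 hj)
  · exact fun i _ => Finset.prod_eq_one fun j hj => if_pos (Finset.mem_Ioi.1 hj)

lemma det_pow_inEmb {R : Type*} [CommRing R] (x : Fin n → R) :
    (Matrix.of fun i j : Fin n => x i ^ (S.inEmb j : ℕ)).det =
      (vandermonde x).det * jacobiTrudi n x n S.parts := by
  have h := det_pow_eq_mul_jacobiTrudi x S.parts
  simp only [← inEmb_rev] at h
  have h1 := Matrix.det_permute' Fin.revPerm (Matrix.of fun i j : Fin n => x i ^ (S.inEmb j : ℕ))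
  have h2 := Matrix.det_permute' Fin.revPerm (vandermonde x)
  have h1' : (Matrix.of fun i j : Fin n => x i ^ (S.inEmb j.rev : ℕ)).det = _ := h1
  have h2' : (Matrix.of fun i j : Fin n => x i ^ (j.rev : ℕ)).det = _ := h2
  rw [h1', h2', mul_assoc] at h
  rcases Int.units_eq_one_or (Equiv.Perm.sign (Fin.revPerm (n := n))) with hs | hs <;>
    simpa [hs] using h

lemma prod_one_sub_mul_eq_sum_of_injective {R : Type*} [CommRing R] [IsDomain R] {x : Fin n → R}
    {y : Fin m → R} (hx : Function.Injective x) (hy : Function.Injective y) :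
    ∏ i, ∏ j, (1 - x i * y j) = ∑ S : FinsetOfCard n m, (-1) ^ (∑ i, S.part i) *
      (jacobiTrudi n x n S.parts * jacobiTrudi m y m S.conjParts) := by
  have hVx : (vandermonde x).det ≠ 0 := det_vandermonde_ne_zero_iff.2 hx
  have hy' : (Matrix.of fun i j : Fin m => y i ^ (j.rev : ℕ)).det =
      ∏ i, ∏ j ∈ Finset.Ioi i, (y i - y j) := by
    have h := det_projVandermonde (fun _ => 1) y
    simp only [one_mul] at h
    rw [← h]
    congr 1
    ext i j
    simp [projVandermonde_apply]
  have hVy : (Matrix.of fun i j : Fin m => y i ^ (j.rev : ℕ)).det ≠ 0 := by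
    rw [hy']
    refine Finset.prod_ne_zero_iff.2 fun i _ => Finset.prod_ne_zero_iff.2 fun j hj => ?_
    exact sub_ne_zero.2 (hy.ne (Finset.mem_Ioi.1 hj).ne)
  have h := det_projVandermonde (Fin.append x fun _ : Fin m => 1) (Fin.append (fun _ => 1) y)
  rw [prod_prod_Ioi_add, det_eq_sum_shufflePerm] at h
  simp only [Fin.append_left, Fin.append_right, one_mul, mul_one] at h
  rw [← det_vandermonde, ← hy'] at h
  apply mul_left_cancel₀ (mul_ne_zero hVx hVy)
  rw [mul_right_comm, ← h, Finset.mul_sum]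
  refine Finset.sum_congr rfl fun S _ => ?_
  have h1 : (projVandermonde (Fin.append x fun _ : Fin m => 1)
      (Fin.append (fun _ => 1) y)).submatrix (Fin.castAdd m) S.inEmb =
      Matrix.of fun i j : Fin n => x i ^ (S.inEmb j : ℕ) := by
    ext i j
    simp [projVandermonde_apply]
  have h2 : (projVandermonde (Fin.append x fun _ : Fin m => 1)
      (Fin.append (fun _ => 1) y)).submatrix (Fin.natAdd n) S.outEmb =
      Matrix.of fun i j : Fin m => y i ^ (S.conjParts j + (j.rev : ℕ)) := by
    ext i j
    rw [Matrix.submatrix_apply, projVandermonde_apply, rev_outEmb]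
    simp
  rw [h1, h2, det_pow_inEmb, det_pow_eq_mul_jacobiTrudi, sign_shufflePerm_one]
  push_cast
  ring

end FinsetOfCard

lemma map_jacobiTrudi {R R' : Type*} [CommRing R] [CommRing R'] (f : R →+* R') {N : ℕ}
    (x : Fin N → R) (k : ℕ) (l : ℕ → ℕ) :
    f (jacobiTrudi N x k l) = jacobiTrudi N (fun i => f (x i)) k l := by
  rw [jacobiTrudi, RingHom.map_det, jacobiTrudi]
  congr 1
  ext i j
  simp only [RingHom.mapMatrix_apply, Matrix.map_apply, Matrix.of_apply, hSymZ]
  split_ifs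
  · simp [hSym, map_multiset_prod]
  · simp

open FinsetOfCard in
lemma prod_one_sub_mul_eq_sum {R : Type*} [CommRing R] {n m : ℕ} (x : Fin n → R) (y : Fin m → R) :
    ∏ i, ∏ j, (1 - x i * y j) = ∑ S : FinsetOfCard n m, (-1) ^ (∑ i, S.part i) *
      (jacobiTrudi n x n S.parts * jacobiTrudi m y m S.conjParts) := by
  have h := prod_one_sub_mul_eq_sum_of_injective
    (x := fun i : Fin n => (MvPolynomial.X (Sum.inl i) : MvPolynomial (Fin n ⊕ Fin m) ℤ))
    (y := fun j : Fin m => MvPolynomial.X (Sum.inr j))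
    ((MvPolynomial.X_injective).comp Sum.inl_injective)
    ((MvPolynomial.X_injective).comp Sum.inr_injective)
  have h' := congrArg (MvPolynomial.eval₂Hom (Int.castRingHom R) (Sum.elim x y)) h
  simp only [map_sum, map_prod, map_sub, map_mul, map_pow, map_neg, map_one, map_jacobiTrudi] at h'
  simpa using h'

open FinsetOfCard in
/-- The dual Cauchy identity. -/
lemma prod_one_sub_mul_smul_eq_sum {R : Type*} [CommRing R] {n m : ℕ} (x : Fin n → R)
    (y : Fin m → R) (u : R) :
    ∏ i, ∏ j, (1 - x i * (u * y j)) = ∑ S : FinsetOfCard n m, (-u) ^ (∑ i, S.part i) *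
      (jacobiTrudi m y m S.conjParts * jacobiTrudi n x n S.parts) := by
  rw [prod_one_sub_mul_eq_sum x fun j => u * y j]
  refine Finset.sum_congr rfl fun S _ => ?_
  rw [jacobiTrudi_smul, sum_conjParts, neg_pow u]
  ring

lemma List.antitone_getD_of_pairwise {l : List ℕ} (h : l.Pairwise (· ≥ ·)) :
    Antitone fun i => l.getD i 0 := by
  intro i j hij
  simp only
  rcases lt_or_ge j l.length with hj | hj
  · rw [List.getD_eq_getElem _ _ hj, List.getD_eq_getElem _ _ (hij.trans_lt hj)]
    rcases hij.eq_or_lt with rfl | hij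
    · exact le_rfl
    · exact List.pairwise_iff_getElem.1 h _ _ _ _ hij
  · rw [List.getD_eq_default _ _ hj]
    exact Nat.zero_le _

lemma List.getD_filter_ne_zero {l : List ℕ} (h : l.Pairwise (· ≥ ·)) (k : ℕ) :
    (l.filter (· ≠ 0)).getD k 0 = l.getD k 0 := by
  induction l generalizing k with
  | nil => simp
  | cons a l ih =>
    rw [List.pairwise_cons] at h
    by_cases ha : a = 0
    · subst ha
      have h0 : ∀ b ∈ l, b = 0 := fun b hb => Nat.le_zero.1 (h.1 b hb)
      rw [List.filter_cons_of_neg (by simp), ih h.2]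
      have h1 (k : ℕ) : l.getD k 0 = 0 := by
        rcases lt_or_ge k l.length with hk | hk
        · rw [List.getD_eq_getElem _ _ hk]
          exact h0 _ (List.getElem_mem hk)
        · exact List.getD_eq_default _ _ hk
      cases k with
      | zero => rw [h1, List.getD_cons_zero]
      | succ k => rw [h1, List.getD_cons_succ, h1]
    · rw [List.filter_cons_of_pos (by simpa using ha)]
      cases k with
      | zero => simp
      | succ k => rw [List.getD_cons_succ, List.getD_cons_succ, ih h.2]

lemma List.eq_of_getD_eq_of_pos {l l' : List ℕ} (hl : ∀ a ∈ l, 0 < a) (hl' : ∀ a ∈ l', 0 < a)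
    (h : ∀ k, l.getD k 0 = l'.getD k 0) : l = l' := by
  induction l generalizing l' with
  | nil =>
    cases l' with
    | nil => rfl
    | cons b l' => exact absurd (h 0) (by simpa using (hl' b (by simp)).ne)
  | cons a l ih =>
    cases l' with
    | nil => exact absurd (h 0) (by simpa using (hl a (by simp)).ne')
    | cons b l' =>
      have h0 : a = b := by simpa using h 0
      rw [h0, ih (fun a ha => hl a (List.mem_cons_of_mem _ ha))
        (fun a ha => hl' a (List.mem_cons_of_mem _ ha)) fun k => by simpa using h (k + 1)]

lemma coe_partsList {j : ℕ} (P : Nat.Partition j) : (partsList P : Multiset ℕ) = P.parts := by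
  rw [partsList, Multiset.coe_reverse, Multiset.sort_eq]

lemma mem_partsList {j : ℕ} {P : Nat.Partition j} {a : ℕ} : a ∈ partsList P ↔ a ∈ P.parts := by
  rw [← coe_partsList, Multiset.mem_coe]

lemma length_partsList {j : ℕ} (P : Nat.Partition j) :
    (partsList P).length = P.parts.card := by
  rw [← coe_partsList, Multiset.coe_card]

lemma pairwise_partsList {j : ℕ} (P : Nat.Partition j) : (partsList P).Pairwise (· ≥ ·) := by
  rw [partsList, List.pairwise_reverse]
  exact Multiset.pairwise_sort _ _

lemma partsList_sigma_injective :
    Function.Injective fun q : (Σ j, Nat.Partition j) => partsList q.2 := by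
  rintro ⟨j, P⟩ ⟨k, Q⟩ h
  have hPQ : P.parts = Q.parts := by
    rw [← coe_partsList, ← coe_partsList]
    exact congrArg _ h
  have hjk : j = k := by rw [← P.parts_sum, ← Q.parts_sum, hPQ]
  subst hjk
  rw [Nat.Partition.ext hPQ]

lemma getD_conjList (l : List ℕ) (k : ℕ) :
    (conjList l).getD k 0 = (l.filter fun a => k < a).length := by
  rcases lt_or_ge k (l.foldr max 0) with hk | hk
  · rw [List.getD_eq_getElem _ _ (by simpa [conjList] using hk)]
    simp [conjList]
  · rw [List.getD_eq_default _ _ (by simpa [conjList] using hk), eq_comm,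
      List.length_eq_zero_iff, List.filter_eq_nil_iff]
    intro a ha
    have : a ≤ l.foldr max 0 := List.le_max_of_le' 0 ha le_rfl
    simpa using this.trans hk

lemma length_conjList_le {l : List ℕ} {m : ℕ} (h : ∀ a ∈ l, a ≤ m) : (conjList l).length ≤ m := by
  simp only [conjList, List.length_map, List.length_range]
  exact List.max_le_of_forall_le l m h

namespace FinsetOfCard

variable {n m : ℕ} (S : FinsetOfCard n m)

/-- The partition attached to `S`, whose diagram is bounded by the lattice path of `S`. -/
def partition : Nat.Partition (∑ i, S.part i) :=
  Nat.Partition.ofSums _ (Finset.univ.val.map S.part) rfl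

lemma parts_partition : S.partition.parts = (Finset.univ.val.map S.part).filter (· ≠ 0) := rfl

lemma card_parts_partition_le : S.partition.parts.card ≤ n := by
  rw [parts_partition]
  exact (Multiset.card_le_card (Multiset.filter_le _ _)).trans (by simp)

lemma le_of_mem_partition {p : ℕ} (hp : p ∈ S.partition.parts) : p ≤ m := by
  rw [parts_partition, Multiset.mem_filter, Multiset.mem_map] at hp
  obtain ⟨⟨i, _, rfl⟩, _⟩ := hp
  exact S.part_le i

lemma getD_partsList_partition (k : ℕ) : (partsList S.partition).getD k 0 = S.parts k := by
  have hsort : (List.ofFn fun i => S.part i.rev).Pairwise (· ≥ ·) := by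
    rw [List.pairwise_ofFn]
    exact fun i j hij => S.part_mono (Fin.rev_le_rev.2 hij.le)
  have h : partsList S.partition = (List.ofFn fun i => S.part i.rev).filter (· ≠ 0) := by
    refine List.Perm.eq_of_pairwise' (r := (· ≥ ·)) (pairwise_partsList _) (hsort.filter _) ?_
    rw [← Multiset.coe_eq_coe, coe_partsList, parts_partition, ← Multiset.filter_coe]
    congr 1
    have : (fun i : Fin n => S.part i.rev) = S.part ∘ Fin.revPerm := rfl
    rw [← Fin.univ_val_map, this, ← Multiset.map_map]
    congr 1
    exact (congrArg Finset.val (Finset.map_univ_equiv Fin.revPerm)).symm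
  rw [h, List.getD_filter_ne_zero hsort, parts]
  split_ifs with hk
  · rw [List.getD_eq_getElem _ _ (by simpa using hk)]
    simp
  · exact List.getD_eq_default _ _ (by simpa using hk)

lemma getD_conjList_partsList_partition (k : ℕ) :
    (conjList (partsList S.partition)).getD k 0 = S.conjParts k := by
  rw [getD_conjList, ← Multiset.coe_card, ← Multiset.filter_coe, coe_partsList, parts_partition,
    Multiset.filter_filter, Multiset.filter_map, Multiset.card_map, conjParts, Finset.card_def,
    Finset.filter_val]
  congr 1
  refine Multiset.filter_congr fun i _ => ?_
  simp
  omega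

lemma schurFn_partition {R : Type*} [CommRing R] (x : Fin n → R) :
    schurFn n (partsList S.partition) x = jacobiTrudi n x n S.parts := by
  rw [schurFn_eq_jacobiTrudi x ((length_partsList _).trans_le S.card_parts_partition_le)]
  simp only [getD_partsList_partition]

lemma schurFn_conj_partition {R : Type*} [CommRing R] (y : Fin m → R) :
    schurFn m (conjList (partsList S.partition)) y = jacobiTrudi m y m S.conjParts := by
  rw [schurFn_eq_jacobiTrudi y (length_conjList_le fun a ha =>
    S.le_of_mem_partition (mem_partsList.1 ha))]
  simp only [getD_conjList_partsList_partition]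

lemma partition_injective :
    Function.Injective fun S : FinsetOfCard n m => (⟨_, S.partition⟩ : Σ j, Nat.Partition j) := by
  intro S T h
  have hl : partsList S.partition = partsList T.partition :=
    congrArg (fun q : (Σ j, Nat.Partition j) => partsList q.2) h
  refine eq_of_inEmb_eq fun i => ⟨i, Fin.ext ?_⟩
  have := S.inEmb_rev i.rev
  rw [← getD_partsList_partition, hl, getD_partsList_partition, ← inEmb_rev] at this
  simpa using this

lemma exists_partition_eq {j : ℕ} (P : Nat.Partition j) (hn : P.parts.card ≤ n)
    (hm : ∀ p ∈ P.parts, p ≤ m) :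
    ∃ S : FinsetOfCard n m, (⟨_, S.partition⟩ : Σ j, Nat.Partition j) = ⟨j, P⟩ := by
  let l (k : ℕ) : ℕ := (partsList P).getD k 0
  have hl : Antitone l := List.antitone_getD_of_pairwise (pairwise_partsList P)
  have hlm (k : ℕ) : l k ≤ m := by
    rcases lt_or_ge k (partsList P).length with hk | hk
    · simp only [l]
      rw [List.getD_eq_getElem _ _ hk]
      exact hm _ (mem_partsList.1 (List.getElem_mem hk))
    · simp only [l]
      rw [List.getD_eq_default _ _ hk]
      exact Nat.zero_le _
  let s (i : Fin n) : Fin (n + m) := ⟨i + l i.rev, by have := hlm i.rev; omega⟩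
  have hs : StrictMono s := fun a b hab => by
    have := hl (Fin.rev_le_rev.2 hab.le : (b.rev : ℕ) ≤ a.rev)
    simp only [s, Fin.lt_def] at hab ⊢
    omega
  let S : FinsetOfCard n m :=
    ⟨Finset.univ.image s, by rw [Finset.card_image_of_injective _ hs.injective]; simp⟩
  have hS : s = S.inEmb :=
    Finset.orderEmbOfFin_unique S.2 (fun i => Finset.mem_image_of_mem _ (Finset.mem_univ i)) hs
  refine ⟨S, partsList_sigma_injective ?_⟩
  refine List.eq_of_getD_eq_of_pos (fun a ha => S.partition.parts_pos (mem_partsList.1 ha))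
    (fun a ha => P.parts_pos (mem_partsList.1 ha)) fun k => ?_
  simp only [getD_partsList_partition]
  rcases lt_or_ge k n with hk | hk
  · have h := S.inEmb_rev ⟨k, hk⟩
    rw [← hS] at h
    simp only [s, Fin.rev_rev, l] at h
    omega
  · rw [parts, dif_neg (by omega), List.getD_eq_default]
    rw [length_partsList]
    omega

lemma sum_part_le : ∑ i, S.part i ≤ n * m := by
  simpa using Finset.sum_le_card_nsmul Finset.univ S.part m fun i _ => S.part_le i

lemma sum_partition_eq {R : Type*} [CommRing R] (u : R) (f : (Σ j, Nat.Partition j) → R) :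
    ∑ j ∈ Finset.range (n * m + 1), u ^ j *
        ∑ P ∈ Finset.univ.filter
          (fun P : Nat.Partition j => P.parts.card ≤ n ∧ ∀ p ∈ P.parts, p ≤ m), f ⟨j, P⟩ =
      ∑ S : FinsetOfCard n m, u ^ (∑ i, S.part i) * f ⟨_, S.partition⟩ := by
  simp only [Finset.mul_sum]
  rw [Finset.sum_sigma']
  symm
  refine Finset.sum_bij (fun S _ => ⟨_, S.partition⟩) (fun S _ => ?_)
    (fun S _ T _ h => partition_injective h) (fun q hq => ?_) fun S _ => rfl
  · simp only [Finset.mem_sigma, Finset.mem_range, Finset.mem_filter, Finset.mem_univ, true_and]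
    exact ⟨Nat.lt_succ_of_le S.sum_part_le, S.card_parts_partition_le,
      fun p => S.le_of_mem_partition⟩
  · simp only [Finset.mem_sigma, Finset.mem_filter, Finset.mem_univ, true_and] at hq
    obtain ⟨S, hS⟩ := exists_partition_eq q.2 hq.2.1 hq.2.2
    exact ⟨S, Finset.mem_univ _, hS⟩

end FinsetOfCard

/-- for endomorphisms `f` (of an `n`-dimensional space, eigenvalues
`ef`) and `g` (of an `m`-dimensional space, eigenvalues `eg`),
`det (Id - u · f ⊗ g) = Σ_{j=0}^{nm} (-u)^j Σ_{|λ|=j} tr ρ_{λ'}(g) · tr ρ_λ(f)`,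
the inner sum being over partitions `λ` of `j` fitting in an `n × m` box, with
`tr ρ_λ(f)` the Schur polynomial `s_λ` of the eigenvalues of `f`. -/
theorem det_id_sub_smul_kronecker_eq_sum_schur
    (n m : ℕ) (F : Matrix (Fin n) (Fin n) ℂ) (G : Matrix (Fin m) (Fin m) ℂ)
    (ef : Fin n → ℂ) (eg : Fin m → ℂ)
    (hef : F.charpoly = ∏ i, (X - C (ef i)))
    (heg : G.charpoly = ∏ i, (X - C (eg i)))
    (u : ℂ) :
    ((1 : Matrix (Fin n × Fin m) (Fin n × Fin m) ℂ)
        - u • Matrix.kroneckerMap (· * ·) F G).det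
      = ∑ j ∈ Finset.range (n * m + 1), (-u) ^ j *
          ∑ P ∈ Finset.univ.filter
              (fun P : Nat.Partition j => P.parts.card ≤ n ∧ ∀ p ∈ P.parts, p ≤ m),
            schurFn m (conjList (partsList P)) eg * schurFn n (partsList P) ef := by
  rw [det_one_sub_smul_kronecker_eq_prod hef heg, prod_one_sub_mul_smul_eq_sum]
  refine Eq.trans ?_ (FinsetOfCard.sum_partition_eq (-u) fun q =>
    schurFn m (conjList (partsList q.2)) eg * schurFn n (partsList q.2) ef).symm
  simp only [FinsetOfCard.schurFn_partition, FinsetOfCard.schurFn_conj_partition]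

end
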